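/- Let λ be a partition of 2n whose set of parts is exactly {1, 2, …, k} for some k ≥ 1, with every part occurring with even (positive) multiplicity. Let ν = λ^t. Then there exists a partition ρ of 2n such that: ρ is of type D (every even part occurs with even multiplicity); ρ is dominated by ν; every partition of 2n of type D that is dominated by ν is dominated by ρ (so ρ is the D-collapse [ν]_D of ν); and every nonzero part of ρ is odd. -/

import Mathlib

/-- A partition of `n`: a non-increasing finitely supported sequence of natural numbers
(indexed from `0`) summing to `n`. -/
structure PartitionOf (n : ℕ) where
  parts : ℕ → ℕ
  antitone : ∀ i j : ℕ, i ≤ j → parts j ≤ parts i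
  finite_support : (Function.support parts).Finite
  sum_eq : ∑ᶠ i, parts i = n

/-- The multiplicity of the value `v` among the parts of the sequence `f`. -/
noncomputable def partMult (f : ℕ → ℕ) (v : ℕ) : ℕ := {i : ℕ | f i = v}.ncard

/-- The transpose (conjugate) sequence: `(f^t)_i = #{j : f_j ≥ i+1}` (0-based indexing,
so this is `#{j : f_j ≥ i}` in 1-based indexing). -/
noncomputable def transposeFn (f : ℕ → ℕ) : ℕ → ℕ := fun i => {j : ℕ | i + 1 ≤ f j}.ncard

/-- Dominance order: `f ⊴ g`. -/
def Dominated (f g : ℕ → ℕ) : Prop :=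
  ∀ k : ℕ, ∑ i ∈ Finset.range k, f i ≤ ∑ i ∈ Finset.range k, g i

/-- A sequence is of type D if every even part occurs with even multiplicity. -/
def IsTypeD (f : ℕ → ℕ) : Prop := ∀ v : ℕ, 0 < v → Even v → Even (partMult f v)

/-- If a type D sequence strictly drops after its first `m` terms, then the sum of these terms
has the same parity as `m`. -/
lemma IsTypeD.even_sum_add_one {f : ℕ → ℕ} (hf : IsTypeD f) (hanti : Antitone f) {m : ℕ}
    (hdrop : ∀ i < m, f m < f i) : Even (∑ i ∈ Finset.range m, (f i + 1)) := by
  rw [Finset.sum_comp (fun v => v + 1) f]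
  refine Finset.even_sum _ fun v hv => ?_
  obtain ⟨i, hi, rfl⟩ := Finset.mem_image.1 hv
  have hmi : f m < f i := hdrop i (Finset.mem_range.1 hi)
  rw [smul_eq_mul]
  rcases Nat.even_or_odd (f i) with he | ho
  · refine Even.mul_right ?_ _
    have hset : {j : ℕ | f j = f i} = ↑({j ∈ Finset.range m | f j = f i} : Finset ℕ) := by
      ext j
      simp only [Set.mem_ofPred_eq, Finset.coe_filter, Finset.mem_range]
      refine ⟨fun hj => ⟨?_, hj⟩, fun hj => hj.2⟩
      by_contra hmj
      have := hanti (not_lt.1 hmj)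
      omega
    have := hf (f i) (by omega) he
    rwa [partMult, hset, Set.ncard_coe_finset] at this
  · exact ho.add_one.mul_left _

lemma PartitionOf.finite_setOf_le {n : ℕ} (lam : PartitionOf n) (v : ℕ) :
    {j : ℕ | v + 1 ≤ lam.parts j}.Finite :=
  lam.finite_support.subset fun j hj => by
    simp only [Set.mem_ofPred_eq] at hj
    simp only [Function.mem_support]
    omega

lemma PartitionOf.transposeFn_eq_add_partMult {n : ℕ} (lam : PartitionOf n) (i : ℕ) :
    transposeFn lam.parts i = transposeFn lam.parts (i + 1) + partMult lam.parts (i + 1) := by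
  have hunion : {j : ℕ | i + 1 ≤ lam.parts j} =
      {j : ℕ | i + 1 + 1 ≤ lam.parts j} ∪ {j : ℕ | lam.parts j = i + 1} := by
    ext j
    simp only [Set.mem_ofPred_eq, Set.mem_union]
    omega
  have hdisj : Disjoint {j : ℕ | i + 1 + 1 ≤ lam.parts j} {j : ℕ | lam.parts j = i + 1} :=
    Set.disjoint_left.2 fun j hj hj' => by
      simp only [Set.mem_ofPred_eq] at hj hj'
      omega
  rw [transposeFn, hunion, Set.ncard_union_eq hdisj (lam.finite_setOf_le _)
    ((lam.finite_setOf_le i).subset fun j hj => ge_of_eq hj)]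
  rfl

lemma PartitionOf.partMult_pos {n : ℕ} (lam : PartitionOf n) {v : ℕ}
    (h : ∃ i, lam.parts i = v + 1) : 0 < partMult lam.parts (v + 1) :=
  (Set.ncard_pos ((lam.finite_setOf_le v).subset fun _ hj => ge_of_eq hj)).2 h

lemma transposeFn_eq_zero {f : ℕ → ℕ} {k i : ℕ} (hf : ∀ j, f j ≤ k) (hi : k ≤ i) :
    transposeFn f i = 0 := by
  have : {j : ℕ | i + 1 ≤ f j} = ∅ := Set.eq_empty_of_forall_notMem fun j hj => by
    simp only [Set.mem_ofPred_eq] at hj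
    have := hf j
    omega
  rw [transposeFn, this, Set.ncard_empty]

lemma PartitionOf.sum_transposeFn {n k : ℕ} (lam : PartitionOf n) (hk : ∀ j, lam.parts j ≤ k) :
    ∑ i ∈ Finset.range k, transposeFn lam.parts i = n := by
  have hcount : ∀ i, transposeFn lam.parts i =
      ∑ j ∈ lam.finite_support.toFinset, if i + 1 ≤ lam.parts j then 1 else 0 := by
    intro i
    rw [← Finset.card_filter, transposeFn, ← Set.ncard_coe_finset]
    congr 1
    ext j
    simp only [Set.mem_ofPred_eq, Finset.coe_filter, Set.Finite.mem_toFinset,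
      Function.mem_support]
    omega
  calc ∑ i ∈ Finset.range k, transposeFn lam.parts i
      = ∑ j ∈ lam.finite_support.toFinset, ∑ i ∈ Finset.range k,
          if i + 1 ≤ lam.parts j then 1 else 0 := by
        rw [Finset.sum_comm]
        exact Finset.sum_congr rfl fun i _ => hcount i
    _ = ∑ j ∈ lam.finite_support.toFinset, lam.parts j := by
        refine Finset.sum_congr rfl fun j _ => ?_
        have hfilter : {i ∈ Finset.range k | i + 1 ≤ lam.parts j} =
            Finset.range (lam.parts j) := by
          ext i
          have := hk j
          simp only [Finset.mem_filter, Finset.mem_range]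
          omega
        rw [← Finset.card_filter, hfilter, Finset.card_range]
    _ = n := by rw [← finsum_eq_sum _ lam.finite_support, lam.sum_eq]

/-- The D-collapse of a sequence with `k` nonzero terms, all even and pairwise distinct. -/
def collapseD (k : ℕ) (nu : ℕ → ℕ) (i : ℕ) : ℕ :=
  if Even i then nu i - 1 else if i ≤ k then nu i + 1 else 0

section collapseD

variable {k : ℕ} {nu : ℕ → ℕ}

lemma collapseD_eq_zero (hzero : ∀ i, k ≤ i → nu i = 0) {i : ℕ} (hi : k < i) :
    collapseD k nu i = 0 := by
  have := hzero i hi.le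
  unfold collapseD
  split_ifs <;> omega

lemma odd_collapseD (heven : ∀ i, Even (nu i)) {i : ℕ} (hi : collapseD k nu i ≠ 0) :
    Odd (collapseD k nu i) := by
  obtain ⟨a, ha⟩ := heven i
  unfold collapseD at *
  rw [Nat.odd_iff]
  split_ifs at * <;> omega

lemma antitone_collapseD (heven : ∀ i, Even (nu i)) (hlt : ∀ i < k, nu (i + 1) < nu i)
    (hzero : ∀ i, k ≤ i → nu i = 0) : Antitone (collapseD k nu) := by
  refine antitone_nat_of_succ_le fun i => ?_
  obtain ⟨a, ha⟩ := heven i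
  obtain ⟨b, hb⟩ := heven (i + 1)
  have h1 := hlt i
  have h2 := hzero (i + 1)
  simp only [collapseD, Nat.even_iff]
  split_ifs <;> omega

lemma sum_range_collapseD (hlt : ∀ i < k, nu (i + 1) < nu i)
    (hzero : ∀ i, k ≤ i → nu i = 0) (m : ℕ) :
    ∑ i ∈ Finset.range m, collapseD k nu i + (if Odd m ∧ m ≤ k then 1 else 0) =
      ∑ i ∈ Finset.range m, nu i := by
  induction m with
  | zero => simp
  | succ m ih =>
    rw [Finset.sum_range_succ, Finset.sum_range_succ, ← ih]
    have h1 := hlt m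
    have h2 := hzero m
    simp only [collapseD, Nat.even_iff, Nat.odd_iff]
    split_ifs <;> omega

lemma dominated_collapseD (heven : ∀ i, Even (nu i)) (hlt : ∀ i < k, nu (i + 1) < nu i)
    (hzero : ∀ i, k ≤ i → nu i = 0) {f : ℕ → ℕ} (hanti : Antitone f) (hf : IsTypeD f)
    (hdom : Dominated f nu) : Dominated f (collapseD k nu) := by
  intro m
  have hsum := sum_range_collapseD hlt hzero m
  have hm := hdom m
  by_cases hodd : Odd m ∧ m ≤ k
  · rw [if_pos hodd] at hsum
    by_contra hcon
    have heq : ∑ i ∈ Finset.range m, f i = ∑ i ∈ Finset.range m, nu i := by omega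
    obtain ⟨⟨l, rfl⟩, hmk⟩ := hodd
    have hprev := hdom (2 * l)
    have hnext := hdom (2 * l + 1 + 1)
    have hnu := hlt (2 * l) hmk
    rw [Finset.sum_range_succ _ (2 * l + 1), Finset.sum_range_succ _ (2 * l + 1)] at hnext
    have hlast := heq
    rw [Finset.sum_range_succ, Finset.sum_range_succ] at hlast
    have hpar := hf.even_sum_add_one hanti (m := 2 * l + 1) fun i hi => by
      have := hanti (show i ≤ 2 * l by omega)
      omega
    rw [Finset.sum_add_distrib, heq, Finset.sum_const, Finset.card_range, smul_eq_mul,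
      mul_one] at hpar
    have hnuEven : Even (∑ i ∈ Finset.range (2 * l + 1), nu i) :=
      Finset.even_sum _ fun i _ => heven i
    rw [Nat.even_iff] at hpar hnuEven
    omega
  · rw [if_neg hodd] at hsum
    omega

end collapseD

/-- let `λ` be a partition of `2n` whose parts are exactly `{1,…,k}`
(`k ≥ 1`), every part with even (positive) multiplicity (the shape of a weakly rigid
special orbit in `so_{2n}`), and let `ν = λ^t`. Then the D-collapse `[ν]_D` exists as a
partition `ρ` of `2n` — type D, dominated by `ν`, and dominance-largest among type-D
partitions of `2n` dominated by `ν` — and all nonzero parts of `ρ` are odd. -/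
theorem collapse_D_of_dual_weakly_rigid_typeD_is_odd
    {n k : ℕ} (hk : 1 ≤ k) (lam : PartitionOf (2 * n))
    (hbound : ∀ i : ℕ, lam.parts i ≤ k)
    (hall : ∀ v : ℕ, 1 ≤ v → v ≤ k → ∃ i : ℕ, lam.parts i = v)
    (heven : ∀ v : ℕ, 1 ≤ v → v ≤ k → Even (partMult lam.parts v))
    (nu : ℕ → ℕ)
    (hnu : nu = transposeFn lam.parts) :
    ∃ rho : PartitionOf (2 * n),
      IsTypeD rho.parts ∧
      Dominated rho.parts nu ∧
      (∀ sigma : PartitionOf (2 * n),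
        IsTypeD sigma.parts → Dominated sigma.parts nu → Dominated sigma.parts rho.parts) ∧
      (∀ i : ℕ, rho.parts i ≠ 0 → Odd (rho.parts i)) := by
  subst hnu
  have hzero : ∀ i, k ≤ i → transposeFn lam.parts i = 0 := fun i => transposeFn_eq_zero hbound
  have hlt : ∀ i < k, transposeFn lam.parts (i + 1) < transposeFn lam.parts i := by
    intro i hi
    have := lam.partMult_pos (hall (i + 1) (by omega) hi)
    have := lam.transposeFn_eq_add_partMult i
    omega
  have hnuEven : ∀ i, Even (transposeFn lam.parts i) := by
    intro i
    rcases le_total k i with hi | hi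
    · rw [hzero i hi]
      exact Even.zero
    · induction hi using Nat.decreasingInduction with
      | self => simp [hzero k le_rfl]
      | of_succ i hi ih =>
        rw [lam.transposeFn_eq_add_partMult i]
        exact ih.add (heven (i + 1) (by omega) hi)
  have hsupp : Function.support (collapseD k (transposeFn lam.parts)) ⊆
      ↑(Finset.range (k + 1)) := by
    intro i hi
    by_contra hik
    refine hi (collapseD_eq_zero hzero ?_)
    simp only [Finset.coe_range, Set.mem_Iio] at hik
    omega
  have hanti := antitone_collapseD hnuEven hlt hzero
  refine ⟨⟨collapseD k (transposeFn lam.parts), fun i j hij => hanti hij,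
    (Finset.finite_toSet _).subset hsupp, ?_⟩, ?_, ?_, ?_, ?_⟩
  · rw [finsum_eq_sum_of_support_subset _ hsupp]
    have hsum := sum_range_collapseD hlt hzero (k + 1)
    rwa [if_neg (by omega), add_zero, Finset.sum_range_succ (transposeFn lam.parts),
      hzero k le_rfl, add_zero, lam.sum_transposeFn hbound] at hsum
  · intro v hv hve
    have hempty : {i : ℕ | collapseD k (transposeFn lam.parts) i = v} = ∅ :=
      Set.eq_empty_of_forall_notMem fun i hi => by
        rw [Set.mem_ofPred_eq] at hi
        exact Nat.not_even_iff_odd.2 (hi ▸ odd_collapseD hnuEven (hi ▸ hv.ne')) hve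
    simp only [partMult, hempty, Set.ncard_empty, Even.zero]
  · intro m
    exact Nat.le.intro (sum_range_collapseD hlt hzero m)
  · intro sigma hsigma hdom
    exact dominated_collapseD hnuEven hlt hzero (fun i j hij => sigma.antitone i j hij) hsigma hdom
  · exact fun i hi => odd_collapseD hnuEven hi
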